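/- For every n ≥ 2, N_2(S^n) = n + 2; that is, the minimal number N of points x_1, …, x_N ∈ S^n admitting weights ν_1, …, ν_N ≥ 0 with ν_1 + ⋯ + ν_N = 1 such that Σ_i ν_i p(x_i) = 0 for every polynomial p on ℝ^{n+1} of degree at most 2 with ∫_{S^n} p dμ = 0 is exactly n + 2. -/

import Mathlib

open MeasureTheory Real Filter Topology ENNReal

noncomputable section

/-- The volume `|S^k|` of the standard unit sphere `S^k ⊆ ℝ^{k+1}`,
computed via the identity `|S^k| = (k+1) · |B^{k+1}|`. -/
def sphereVol (k : ℕ) : ℝ :=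
  ((k : ℝ) + 1) * (MeasureTheory.volume (Metric.ball (0 : EuclideanSpace ℝ (Fin (k + 1))) 1)).toReal

/-- The Moser–Trudinger constant `a_n = n |S^{n-1}|^{1/(n-1)}`. -/
def aConst (n : ℕ) : ℝ := n * sphereVol (n - 1) ^ (1 / ((n : ℝ) - 1))

/-- The constant `α_n = ((n-1)/n)^{n-1} / |S^{n-1}|`. -/
def alphaConst (n : ℕ) : ℝ := (((n : ℝ) - 1) / n) ^ (n - 1) / sphereVol (n - 1)

/-- The unit sphere `S^n ⊆ ℝ^{n+1}`. -/
abbrev UnitSphere (n : ℕ) := Metric.sphere (0 : EuclideanSpace ℝ (Fin (n + 1))) 1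

/-- The standard (surface) measure `μ` on `S^n`. -/
def sphereMeasure (n : ℕ) : Measure (UnitSphere n) :=
  (MeasureTheory.volume : Measure (EuclideanSpace ℝ (Fin (n + 1)))).toSphere

/-- Evaluation of a polynomial on `ℝ^{n+1}` at a point of `S^n`. -/
def polyEval {n : ℕ} (p : MvPolynomial (Fin (n + 1)) ℝ) (x : UnitSphere n) : ℝ :=
  MvPolynomial.eval (fun j => (x : EuclideanSpace ℝ (Fin (n + 1))) j) p

/-- `p ∈ P̊_m`: a polynomial on `ℝ^{n+1}` of degree at most `m` with `∫_{S^n} p dμ = 0`. -/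
def MeanZeroPoly (n m : ℕ) (p : MvPolynomial (Fin (n + 1)) ℝ) : Prop :=
  p.totalDegree ≤ m ∧ (∫ x, polyEval p x ∂(sphereMeasure n)) = 0

/-- `N ∈ 𝒩_m(S^n)`: there are `N` points of `S^n` and nonnegative weights summing to `1`
annihilating every `p ∈ P̊_m`. -/
def IsQuadratureCount (n m N : ℕ) : Prop :=
  ∃ (x : Fin N → UnitSphere n) (w : Fin N → ℝ),
    (∀ i, 0 ≤ w i) ∧ (∑ i, w i) = 1 ∧
      ∀ p : MvPolynomial (Fin (n + 1)) ℝ, MeanZeroPoly n m p →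
        (∑ i, w i * polyEval p (x i)) = 0

/-- `N_m(S^n) = min 𝒩_m(S^n)`. -/
def minQuadratureCount (n m : ℕ) : ℕ := sInf {N | IsQuadratureCount n m N}

section SphereMeasure

variable {E : Type*} [NormedAddCommGroup E] [NormedSpace ℝ E]

/-- The map of the unit sphere induced by a linear isometric equivalence. -/
def LinearIsometryEquiv.sphereMap (e : E ≃ₗᵢ[ℝ] E) :
    Metric.sphere (0 : E) 1 ≃ₜ Metric.sphere (0 : E) 1 :=
  e.toHomeomorph.subtype fun x => by simp

@[simp]
theorem LinearIsometryEquiv.coe_sphereMap (e : E ≃ₗᵢ[ℝ] E) (x : Metric.sphere (0 : E) 1) :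
    (e.sphereMap x : E) = e x := rfl

open scoped Pointwise in
theorem measurePreserving_sphereMap [MeasurableSpace E] [BorelSpace E] {μ : Measure E}
    (e : E ≃ₗᵢ[ℝ] E) (he : MeasurePreserving e μ μ) :
    MeasurePreserving e.sphereMap μ.toSphere μ.toSphere := by
  refine ⟨e.sphereMap.continuous.measurable, Measure.ext fun s hs => ?_⟩
  rw [Measure.map_apply e.sphereMap.continuous.measurable hs, Measure.toSphere_apply' _ hs,
    Measure.toSphere_apply' _ (e.sphereMap.continuous.measurable hs),
    ← he.measure_preimage_emb e.toHomeomorph.measurableEmbedding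
      (Set.Ioo (0 : ℝ) 1 • (Subtype.val '' s))]
  congr 2
  ext y
  simp only [Set.mem_smul, Set.mem_image, Set.mem_preimage]
  constructor
  · rintro ⟨r, hr, _, ⟨x, hx, rfl⟩, rfl⟩
    exact ⟨r, hr, _, ⟨_, hx, rfl⟩, by simp⟩
  · rintro ⟨r, hr, _, ⟨x, hx, rfl⟩, hy⟩
    refine ⟨r, hr, _, ⟨e.sphereMap.symm x, by simpa using hx, rfl⟩, e.injective ?_⟩
    rw [map_smul, ← LinearIsometryEquiv.coe_sphereMap, Homeomorph.apply_symm_apply, hy]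

end SphereMeasure

section Moments

variable {n : ℕ}

instance : IsFiniteMeasure (sphereMeasure n) := by
  unfold sphereMeasure; infer_instance

instance : (sphereMeasure n).IsOpenPosMeasure := by
  unfold sphereMeasure; infer_instance

theorem sphereMeasure_real_univ_pos : 0 < (sphereMeasure n).real Set.univ := by
  have : sphereMeasure n ≠ 0 := Measure.toSphere_ne_zero _
  simpa [measureReal_def, ENNReal.toReal_pos_iff, pos_iff_ne_zero] using this

theorem continuous_polyEval (p : MvPolynomial (Fin (n + 1)) ℝ) :
    Continuous (polyEval p : UnitSphere n → ℝ) := by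
  unfold polyEval
  exact (MvPolynomial.continuous_eval p).comp (by fun_prop)

theorem integrable_of_continuous {f : UnitSphere n → ℝ} (hf : Continuous f) :
    Integrable f (sphereMeasure n) :=
  hf.integrable_of_hasCompactSupport (HasCompactSupport.of_compactSpace f)

theorem integral_comp_sphereMap
    (e : EuclideanSpace ℝ (Fin (n + 1)) ≃ₗᵢ[ℝ] EuclideanSpace ℝ (Fin (n + 1)))
    (f : UnitSphere n → ℝ) :
    ∫ x, f (e.sphereMap x) ∂sphereMeasure n = ∫ x, f x ∂sphereMeasure n :=
  (measurePreserving_sphereMap e e.measurePreserving).integral_comp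
    e.sphereMap.measurableEmbedding f

/-- The reflection of Euclidean space in the hyperplane orthogonal to a coordinate axis. -/
def coordReflection (i : Fin (n + 1)) :
    EuclideanSpace ℝ (Fin (n + 1)) ≃ₗᵢ[ℝ] EuclideanSpace ℝ (Fin (n + 1)) :=
  LinearIsometryEquiv.piLpCongrRight 2 fun k =>
    if k = i then LinearIsometryEquiv.neg ℝ else LinearIsometryEquiv.refl ℝ ℝ

theorem coordReflection_apply (i k : Fin (n + 1)) (x : EuclideanSpace ℝ (Fin (n + 1))) :
    coordReflection i x k = if k = i then -x k else x k := by
  by_cases h : k = i <;> simp [coordReflection, h]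

theorem integral_coord (i : Fin (n + 1)) :
    ∫ x : UnitSphere n, x.1 i ∂sphereMeasure n = 0 := by
  have h := integral_comp_sphereMap (coordReflection i) fun x : UnitSphere n => x.1 i
  simp only [LinearIsometryEquiv.coe_sphereMap, coordReflection_apply, if_true, integral_neg] at h
  linarith

theorem integral_coord_mul_coord_of_ne {i j : Fin (n + 1)} (hij : i ≠ j) :
    ∫ x : UnitSphere n, x.1 i * x.1 j ∂sphereMeasure n = 0 := by
  have h := integral_comp_sphereMap (coordReflection i) fun x : UnitSphere n => x.1 i * x.1 j
  simp only [LinearIsometryEquiv.coe_sphereMap, coordReflection_apply, if_true, hij.symm, if_false,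
    neg_mul, integral_neg] at h
  linarith

theorem sum_coord_mul_self (x : UnitSphere n) : ∑ i, x.1 i * x.1 i = 1 := by
  have h := EuclideanSpace.real_norm_sq_eq x.1
  rw [norm_eq_of_mem_sphere] at h
  simpa [sq] using h.symm

theorem integral_coord_mul_self (i : Fin (n + 1)) :
    ∫ x : UnitSphere n, x.1 i * x.1 i ∂sphereMeasure n =
      (sphereMeasure n).real Set.univ / (n + 1) := by
  have hswap (j : Fin (n + 1)) : ∫ x : UnitSphere n, x.1 j * x.1 j ∂sphereMeasure n =
      ∫ x : UnitSphere n, x.1 i * x.1 i ∂sphereMeasure n := by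
    rw [← integral_comp_sphereMap
      (LinearIsometryEquiv.piLpCongrLeft 2 ℝ ℝ (Equiv.swap i j))
      fun x : UnitSphere n => x.1 i * x.1 i]
    simp [Equiv.piCongrLeft']
  have hsum : ∑ j, ∫ x : UnitSphere n, x.1 j * x.1 j ∂sphereMeasure n =
      (sphereMeasure n).real Set.univ := by
    rw [← integral_finsetSum _ fun j _ => integrable_of_continuous (by fun_prop)]
    simp [sum_coord_mul_self]
  simp only [hswap, Finset.sum_const, Finset.card_univ, Fintype.card_fin, nsmul_eq_mul] at hsum
  rw [_root_.eq_div_iff (by positivity), ← hsum]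
  push_cast
  ring

/-- Integration of polynomials over the unit sphere, as a linear functional. -/
def sphereIntegral (n : ℕ) : MvPolynomial (Fin (n + 1)) ℝ →ₗ[ℝ] ℝ where
  toFun p := ∫ x, polyEval p x ∂sphereMeasure n
  map_add' p q := by
    rw [← integral_add (integrable_of_continuous (continuous_polyEval p))
      (integrable_of_continuous (continuous_polyEval q))]
    simp [polyEval]
  map_smul' c p := by
    simp [polyEval, integral_const_mul]

theorem sphereIntegral_apply (p : MvPolynomial (Fin (n + 1)) ℝ) :
    sphereIntegral n p = ∫ x, polyEval p x ∂sphereMeasure n := rfl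

/-- A weighted sum of values of a polynomial on the unit sphere, as a linear functional. -/
def quadratureSum {N : ℕ} (x : Fin N → UnitSphere n) (w : Fin N → ℝ) :
    MvPolynomial (Fin (n + 1)) ℝ →ₗ[ℝ] ℝ where
  toFun p := ∑ i, w i * polyEval p (x i)
  map_add' p q := by simp [polyEval, mul_add, Finset.sum_add_distrib]
  map_smul' c p := by simp [polyEval, Finset.mul_sum, mul_left_comm]

theorem quadratureSum_apply {N : ℕ} (x : Fin N → UnitSphere n) (w : Fin N → ℝ)
    (p : MvPolynomial (Fin (n + 1)) ℝ) :
    quadratureSum x w p = ∑ i, w i * polyEval p (x i) := rfl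

end Moments

section Polynomials

open MvPolynomial

theorem Finsupp.exists_eq_single_add {σ : Type*} {s : σ →₀ ℕ} (hs : s ≠ 0) :
    ∃ (i : σ) (t : σ →₀ ℕ), s = Finsupp.single i 1 + t ∧ s.degree = t.degree + 1 := by
  obtain ⟨i, hi⟩ := Finsupp.ne_iff.1 hs
  have h : Finsupp.single i 1 ≤ s := by
    simpa [Finsupp.single_le_iff, Nat.one_le_iff_ne_zero] using hi
  obtain ⟨t, rfl⟩ := exists_add_of_le h
  exact ⟨i, t, rfl, by simp [add_comm]⟩

/-- Linear functionals on polynomials which agree on `1`, `X i` and `X i * X j` agree on all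
polynomials of degree at most `2`. -/
theorem MvPolynomial.linearMap_eq_of_totalDegree_le_two {σ R M : Type*} [CommSemiring R]
    [AddCommMonoid M] [Module R M] {L L' : MvPolynomial σ R →ₗ[R] M} (h₀ : L 1 = L' 1)
    (h₁ : ∀ i, L (X i) = L' (X i)) (h₂ : ∀ i j, L (X i * X j) = L' (X i * X j))
    {p : MvPolynomial σ R} (hp : p.totalDegree ≤ 2) : L p = L' p := by
  have hmon (s : σ →₀ ℕ) (hs : s.degree ≤ 2) : L (monomial s 1) = L' (monomial s 1) := by
    rcases eq_or_ne s 0 with rfl | hs0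
    · simpa using h₀
    obtain ⟨i, t, rfl, hd⟩ := Finsupp.exists_eq_single_add hs0
    rcases eq_or_ne t 0 with rfl | ht0
    · simpa [X] using h₁ i
    obtain ⟨j, u, rfl, hd'⟩ := Finsupp.exists_eq_single_add ht0
    obtain rfl : u = 0 := (Finsupp.degree_eq_zero_iff u).1 (by omega)
    simpa [X, monomial_mul] using h₂ i j
  rw [p.as_sum, map_sum, map_sum]
  refine Finset.sum_congr rfl fun s hs => ?_
  have := hmon s ((le_totalDegree hs).trans hp)
  rw [← mul_one (coeff s p), ← smul_eq_mul, ← smul_monomial, map_smul, map_smul, this]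

end Polynomials

section Simplex

/-- The vertices of a regular simplex inscribed in `S^n`: they are balanced and form a tight
frame. -/
theorem exists_regular_simplex (n : ℕ) :
    ∃ x : Fin (n + 2) → UnitSphere n, (∀ j, ∑ k, (x k).1 j = 0) ∧
      ∀ i j, ∑ k, (x k).1 i * (x k).1 j = if i = j then ((n : ℝ) + 2) / (n + 1) else 0 := by
  set u : EuclideanSpace ℝ (Fin (n + 2)) := WithLp.toLp 2 fun _ => (√((n : ℝ) + 2))⁻¹ with hu
  have hu1 : ‖u‖ = 1 := by
    rw [EuclideanSpace.norm_eq]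
    have : (0 : ℝ) < n + 2 := by positivity
    simp [hu, Real.sq_sqrt this.le, this.ne']
  obtain ⟨b, hb⟩ := Orthonormal.exists_orthonormalBasis_extension_of_card_eq (𝕜 := ℝ)
    (E := EuclideanSpace ℝ (Fin (n + 2))) (ι := Fin (n + 2)) (by simp) (v := fun _ => u)
    (s := {0}) ⟨fun _ => hu1, fun i j hij => (hij (Subsingleton.elim i j)).elim⟩
  replace hb : b 0 = u := hb 0 rfl
  have hrow (i j) : ∑ k, b i k * b j k = if i = j then 1 else 0 := by
    have := orthonormal_iff_ite.1 b.orthonormal i j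
    simpa [PiLp.inner_apply, mul_comm] using this
  have hcol (k) : ∑ i, b i k ^ 2 = 1 := by
    have := b.sum_sq_norm_inner_right (EuclideanSpace.single k (1 : ℝ))
    simpa [EuclideanSpace.inner_single_right] using this
  set c : ℝ := √(((n : ℝ) + 2) / (n + 1)) with hc
  have hc2 : c * c = ((n : ℝ) + 2) / (n + 1) := Real.mul_self_sqrt (by positivity)
  have hmem (k) : (WithLp.toLp 2 fun j : Fin (n + 1) => c * b j.succ k) ∈
      Metric.sphere (0 : EuclideanSpace ℝ (Fin (n + 1))) 1 := by
    have h := hcol k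
    rw [Fin.sum_univ_succ, hb] at h
    have h0 : u k ^ 2 = ((n : ℝ) + 2)⁻¹ := by
      simp only [hu, inv_pow]
      rw [Real.sq_sqrt (by positivity)]
    rw [mem_sphere_zero_iff_norm, EuclideanSpace.norm_eq, Real.sqrt_eq_one]
    simp only [Real.norm_eq_abs, sq_abs, mul_pow, ← Finset.mul_sum]
    rw [eq_sub_of_add_eq' h, h0, sq, hc2]
    field_simp
    ring
  refine ⟨fun k => ⟨_, hmem k⟩, fun j => ?_, fun i j => ?_⟩
  · have h := hrow 0 j.succ
    rw [if_neg (Fin.succ_ne_zero j).symm, hb] at h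
    simp only [hu, ← Finset.mul_sum] at h ⊢
    rcases mul_eq_zero.1 h with h | h
    · exact absurd h (by positivity)
    · rw [h, mul_zero]
  · have h := hrow i.succ j.succ
    simp only [Fin.succ_inj] at h
    simp only [mul_mul_mul_comm c, ← Finset.mul_sum, h, hc2, mul_ite, mul_one, mul_zero]

theorem isQuadratureCount_two (n : ℕ) : IsQuadratureCount n 2 (n + 2) := by
  obtain ⟨x, hx₁, hx₂⟩ := exists_regular_simplex n
  have hn : (0 : ℝ) < n + 2 := by positivity
  refine ⟨x, fun _ => ((n : ℝ) + 2)⁻¹, fun _ => by positivity, by simp [hn.ne'], ?_⟩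
  rintro p ⟨hdeg, hint⟩
  set V := (sphereMeasure n).real Set.univ with hV
  have hV0 : V ≠ 0 := sphereMeasure_real_univ_pos.ne'
  have key : quadratureSum x (fun _ => ((n : ℝ) + 2)⁻¹) p = (V⁻¹ • sphereIntegral n) p := by
    refine MvPolynomial.linearMap_eq_of_totalDegree_le_two ?_ (fun i => ?_) (fun i j => ?_) hdeg
    · simp [quadratureSum_apply, sphereIntegral_apply, polyEval, hn.ne', ← hV, hV0]
    · simp [quadratureSum_apply, sphereIntegral_apply, polyEval, ← Finset.mul_sum, hx₁,
        integral_coord]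
    · rcases eq_or_ne i j with rfl | hij
      · simp only [quadratureSum_apply, sphereIntegral_apply, polyEval, ← Finset.mul_sum, map_mul,
          MvPolynomial.eval_X, hx₂, LinearMap.smul_apply, integral_coord_mul_self, ← hV, if_true,
          smul_eq_mul]
        field_simp
      · simp [quadratureSum_apply, sphereIntegral_apply, polyEval, ← Finset.mul_sum, hx₂, hij,
          integral_coord_mul_coord_of_ne]
  rwa [LinearMap.smul_apply, sphereIntegral_apply, hint, smul_zero] at key

end Simplex

section LowerBound

variable {n : ℕ}

/-- A quadrature rule exact on mean-zero polynomials computes the mean of every polynomial. -/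
theorem quadratureSum_eq_mean {m N : ℕ} {x : Fin N → UnitSphere n} {w : Fin N → ℝ}
    (hw : ∑ i, w i = 1)
    (h : ∀ p : MvPolynomial (Fin (n + 1)) ℝ, MeanZeroPoly n m p →
      (∑ i, w i * polyEval p (x i)) = 0)
    {p : MvPolynomial (Fin (n + 1)) ℝ} (hp : p.totalDegree ≤ m) :
    quadratureSum x w p = sphereIntegral n p / (sphereMeasure n).real Set.univ := by
  set a := sphereIntegral n p / (sphereMeasure n).real Set.univ with ha
  have hV := (sphereMeasure_real_univ_pos (n := n)).ne'
  have h₁ : sphereIntegral n (MvPolynomial.C a) = sphereIntegral n p := by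
    rw [sphereIntegral_apply]
    simp [polyEval, ha, mul_div_cancel₀ _ hV]
  have h₂ : quadratureSum x w (MvPolynomial.C a) = a := by
    simp [quadratureSum_apply, polyEval, ← Finset.sum_mul, hw]
  have h₃ : quadratureSum x w (p - MvPolynomial.C a) = 0 := by
    refine h _ ⟨(MvPolynomial.totalDegree_sub_C_le p a).trans hp, ?_⟩
    rw [← sphereIntegral_apply, map_sub, h₁, sub_self]
  rw [map_sub, h₂] at h₃
  linarith

theorem polyEval_eq_zero_of_sphereIntegral_sq_eq_zero {p : MvPolynomial (Fin (n + 1)) ℝ}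
    (h : sphereIntegral n (p ^ 2) = 0) (x : UnitSphere n) : polyEval p x = 0 := by
  have hc := continuous_polyEval (p ^ 2)
  rw [sphereIntegral_apply, integral_eq_zero_iff_of_nonneg (fun x => by simp [polyEval, sq_nonneg])
    (integrable_of_continuous hc), hc.ae_eq_iff_eq _ continuous_zero] at h
  simpa [polyEval] using congrFun h x

/-- The affine polynomial with constant term `v.1` and linear coefficients `v.2`. -/
def affinePoly (v : ℝ × (Fin (n + 1) → ℝ)) : MvPolynomial (Fin (n + 1)) ℝ :=
  MvPolynomial.C v.1 + ∑ j, MvPolynomial.C (v.2 j) * MvPolynomial.X j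

theorem totalDegree_affinePoly_le (v : ℝ × (Fin (n + 1) → ℝ)) :
    (affinePoly v).totalDegree ≤ 1 := by
  refine (MvPolynomial.totalDegree_add _ _).trans (max_le (by simp) ?_)
  refine MvPolynomial.totalDegree_finsetSum_le fun j _ => ?_
  refine (MvPolynomial.totalDegree_mul _ _).trans ?_
  simp

theorem polyEval_affinePoly (v : ℝ × (Fin (n + 1) → ℝ)) (x : UnitSphere n) :
    polyEval (affinePoly v) x = v.1 + ∑ j, v.2 j * x.1 j := by
  simp [polyEval, affinePoly]

theorem eq_zero_of_polyEval_affinePoly_eq_zero {v : ℝ × (Fin (n + 1) → ℝ)}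
    (h : ∀ x : UnitSphere n, polyEval (affinePoly v) x = 0) : v = 0 := by
  have hadd (j : Fin (n + 1)) : v.1 + v.2 j = 0 := by
    simpa [polyEval_affinePoly] using h ⟨EuclideanSpace.single j 1, by simp⟩
  have hsub (j : Fin (n + 1)) : v.1 - v.2 j = 0 := by
    simpa [polyEval_affinePoly, sub_eq_add_neg] using
      h ⟨-EuclideanSpace.single j 1, by simp⟩
  refine Prod.ext ?_ (funext fun j => ?_)
  · linarith [hadd 0, hsub 0, show (0 : ℝ × (Fin (n + 1) → ℝ)).1 = 0 from rfl]
  · linarith [hadd j, hsub j, show (0 : ℝ × (Fin (n + 1) → ℝ)).2 j = 0 from rfl]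

theorem IsQuadratureCount.add_two_le {N : ℕ} (h : IsQuadratureCount n 2 N) : n + 2 ≤ N := by
  obtain ⟨x, w, -, hw, h⟩ := h
  let L : ℝ × (Fin (n + 1) → ℝ) →ₗ[ℝ] Fin N → ℝ :=
    { toFun := fun v k => polyEval (affinePoly v) (x k)
      map_add' := fun v v' => by
        ext k
        simp [polyEval_affinePoly, add_mul, Finset.sum_add_distrib]
        ring
      map_smul' := fun c v => by
        ext k
        simp [polyEval_affinePoly, mul_add, Finset.mul_sum, mul_assoc] }
  have hL : Function.Injective L := by
    refine (injective_iff_map_eq_zero L).2 fun v hv => ?_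
    refine eq_zero_of_polyEval_affinePoly_eq_zero
      (polyEval_eq_zero_of_sphereIntegral_sq_eq_zero ?_)
    have hdeg : (affinePoly v ^ 2).totalDegree ≤ 2 :=
      (MvPolynomial.totalDegree_pow _ 2).trans (by linarith [totalDegree_affinePoly_le v])
    have hzero : quadratureSum x w (affinePoly v ^ 2) = 0 := by
      rw [quadratureSum_apply]
      refine Finset.sum_eq_zero fun k _ => ?_
      have hk : polyEval (affinePoly v) (x k) = 0 := congrFun hv k
      rw [polyEval] at hk ⊢
      simp [hk]
    rw [quadratureSum_eq_mean hw h hdeg] at hzero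
    exact (div_eq_zero_iff.1 hzero).resolve_right sphereMeasure_real_univ_pos.ne'
  have hfin := LinearMap.finrank_le_finrank_of_injective hL
  simp only [Module.finrank_prod, Module.finrank_self, Module.finrank_fin_fun] at hfin
  omega

end LowerBound

/-- **Lemma 3.1.**  For every `n ≥ 2`, `N_2(S^n) = n + 2`: the minimal number of points of
`S^n` admitting nonnegative weights summing to `1` which annihilate every polynomial on
`ℝ^{n+1}` of degree at most `2` with zero mean over `S^n` is exactly `n + 2`. -/
theorem minQuadratureCount_deg_two (n : ℕ) (hn : 2 ≤ n) :
    minQuadratureCount n 2 = n + 2 := by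
  exact le_antisymm (Nat.sInf_le (isQuadratureCount_two n))
    (le_csInf ⟨_, isQuadratureCount_two n⟩ fun _ hN => hN.add_two_le)
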